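/- There exists ε₀ > 0, depending only on S and k, such that for every plain k-fission H of S within any ε ≤ ε₀ the following holds: for every point v of S, every point of the v-cluster has the same degree in the halving edges graph of H, and this common degree equals the degree of v in the halving edges graph of S. -/

import Mathlib

noncomputable section

/-- The plane. -/
abbrev Pt : Type := EuclideanSpace ℝ (Fin 2)

/-- Signed determinant of the triple `(p, q, r)`: positive iff `r` lies on the left of
the directed line from `p` to `q`. -/
def det2 (p q r : Pt) : ℝ :=
  (q 0 - p 0) * (r 1 - p 1) - (q 1 - p 1) * (r 0 - p 0)

/-- A finite set of points in the plane is in general position if no three of its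
(distinct) points are collinear. -/
def GenPos (S : Finset Pt) : Prop :=
  ∀ p ∈ S, ∀ q ∈ S, ∀ r ∈ S, p ≠ q → p ≠ r → q ≠ r →
    ¬ Collinear ℝ ({p, q, r} : Set Pt)

/-- `{p, q}` is a halving edge of `S`: `p, q` are distinct points of `S` and the open
half-planes on the two sides of the line through `p` and `q` each contain exactly
`(|S| - 2)/2` points of `S`. -/
def HalvingEdge (S : Finset Pt) (p q : Pt) : Prop :=
  p ∈ S ∧ q ∈ S ∧ p ≠ q ∧
    {r ∈ (S : Set Pt) | 0 < det2 p q r}.ncard = (S.card - 2) / 2 ∧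
    {r ∈ (S : Set Pt) | det2 p q r < 0}.ncard = (S.card - 2) / 2

/-- The halving edges graph of `S` (as a graph on the whole plane; all vertices
outside `S` are isolated). -/
def halvingGraph (S : Finset Pt) : SimpleGraph Pt :=
  SimpleGraph.fromRel (HalvingEdge S)

/-- The number of halving edges of `S`. -/
def halvingEdgeCount (S : Finset Pt) : ℕ :=
  {e : Sym2 Pt | ∃ p q, e = s(p, q) ∧ HalvingEdge S p q}.ncard

/-- `H`, together with the cluster map `cl`, is a `k`-fission of `S` within `ε`:
`H` is a set of `k * |S|` points in general position partitioned into clusters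
`cl v` of `k` points, one for each `v ∈ S`, with each point of the `v`-cluster
within distance `ε` of `v`. -/
structure IsFission (S : Finset Pt) (k : ℕ) (ε : ℝ) (H : Finset Pt)
    (cl : Pt → Finset Pt) : Prop where
  genPos : GenPos H
  cluster_card : ∀ v ∈ S, (cl v).card = k
  disj : ∀ v ∈ S, ∀ w ∈ S, v ≠ w → Disjoint (cl v) (cl w)
  union_eq : (H : Set Pt) = ⋃ v ∈ S, (cl v : Set Pt)
  close : ∀ v ∈ S, ∀ x ∈ cl v, dist x v ≤ ε

/-- A fission is plain if no halving edge of `H` has both endpoints in the same cluster. -/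
def IsPlain (S : Finset Pt) (H : Finset Pt) (cl : Pt → Finset Pt) : Prop :=
  ∀ v ∈ S, ∀ p ∈ cl v, ∀ q ∈ cl v, ¬ HalvingEdge H p q


local instance : DecidableEq Pt := Classical.decEq _

open Finset Filter Topology

/-- The left side of the line through `p` with direction `(a, b)` is where this form is positive. -/
def lineForm (a b : ℝ) (p z : Pt) : ℝ :=
  a * (z 1 - p 1) - b * (z 0 - p 0)

/-- The form of the line through `p` whose direction is `w - v` plus `t` times its left normal. -/
def tiltForm (v w : Pt) (t : ℝ) (p z : Pt) : ℝ :=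
  lineForm ((w 0 - v 0) - t * (w 1 - v 1)) ((w 1 - v 1) + t * (w 0 - v 0)) p z

lemma sq_add_sq_pos {a b : ℝ} (hab : a ≠ 0 ∨ b ≠ 0) : 0 < a ^ 2 + b ^ 2 := by
  rcases hab with h | h <;> positivity

lemma coord_ne_of_ne {v w : Pt} (h : v ≠ w) : w 0 - v 0 ≠ 0 ∨ w 1 - v 1 ≠ 0 := by
  by_contra! hc
  apply h
  ext i
  fin_cases i
  · exact (sub_eq_zero.1 hc.1).symm
  · exact (sub_eq_zero.1 hc.2).symm

lemma exists_param_of_lineForm_eq_zero {a b : ℝ} (hab : a ≠ 0 ∨ b ≠ 0) {p q : Pt}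
    (h : lineForm a b p q = 0) : ∃ s : ℝ, q 0 - p 0 = s * a ∧ q 1 - p 1 = s * b := by
  have h2 := sq_add_sq_pos hab
  unfold lineForm at h
  refine ⟨((q 0 - p 0) * a + (q 1 - p 1) * b) / (a ^ 2 + b ^ 2), ?_, ?_⟩
  · field_simp
    linear_combination (-b) * h
  · field_simp
    linear_combination a * h

lemma collinear_of_lineForm_eq_zero {a b : ℝ} (hab : a ≠ 0 ∨ b ≠ 0) {p q r : Pt}
    (hq : lineForm a b p q = 0) (hr : lineForm a b p r = 0) :
    Collinear ℝ ({p, q, r} : Set Pt) := by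
  rw [collinear_iff_of_mem (p₀ := p) (by simp)]
  have key : ∀ z : Pt, lineForm a b p z = 0 → ∃ s : ℝ, z = s • (!₂[a, b] : Pt) +ᵥ p := by
    intro z hz
    obtain ⟨s, h0, h1⟩ := exists_param_of_lineForm_eq_zero hab hz
    refine ⟨s, ?_⟩
    ext i
    fin_cases i
    · simp
      linarith
    · simp
      linarith
  refine ⟨!₂[a, b], ?_⟩
  rintro z (rfl | rfl | rfl)
  · exact ⟨0, by simp⟩
  · exact key _ hq
  · exact key _ hr

lemma GenPos.eq_of_lineForm_eq_zero {S : Finset Pt} (hS : GenPos S) {a b : ℝ}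
    (hab : a ≠ 0 ∨ b ≠ 0) {p q r : Pt} (hp : p ∈ S) (hq : q ∈ S) (hr : r ∈ S)
    (hpq : p ≠ q) (hpr : p ≠ r) (hfq : lineForm a b p q = 0) (hfr : lineForm a b p r = 0) :
    q = r := by
  by_contra hqr
  exact hS p hp q hq r hr hpq hpr hqr (collinear_of_lineForm_eq_zero hab hfq hfr)

lemma GenPos.det2_ne_zero {S : Finset Pt} (hS : GenPos S) {p q r : Pt} (hp : p ∈ S)
    (hq : q ∈ S) (hr : r ∈ S) (hpq : p ≠ q) (hpr : p ≠ r) (hqr : q ≠ r) : det2 p q r ≠ 0 := by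
  intro h
  refine hqr (hS.eq_of_lineForm_eq_zero (coord_ne_of_ne hpq) hp hq hr hpq hpr ?_ h)
  unfold lineForm
  ring

lemma det2_self_left (p q : Pt) : det2 p q p = 0 := by
  unfold det2
  ring

lemma det2_self_right (p q : Pt) : det2 p q q = 0 := by
  unfold det2
  ring

lemma GenPos.card_left_add_card_right {S : Finset Pt} (hS : GenPos S) {p q : Pt} (hp : p ∈ S)
    (hq : q ∈ S) (hpq : p ≠ q) :
    #{r ∈ S | 0 < det2 p q r} + #{r ∈ S | det2 p q r < 0} + 2 = #S := by
  have hpair : #({p, q} : Finset Pt) = 2 := card_pair hpq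
  rw [← hpair, ← card_union_of_disjoint, ← card_union_of_disjoint]
  · congr 1
    ext r
    simp only [mem_union, mem_filter, mem_insert, mem_singleton]
    constructor
    · rintro ((h | h) | rfl | rfl)
      exacts [h.1, h.1, hp, hq]
    · intro hr
      by_cases h1 : p = r
      · exact Or.inr (Or.inl h1.symm)
      by_cases h2 : q = r
      · exact Or.inr (Or.inr h2.symm)
      rcases lt_or_gt_of_ne (hS.det2_ne_zero hp hq hr hpq h1 h2) with h | h
      · exact Or.inl (Or.inr ⟨hr, h⟩)
      · exact Or.inl (Or.inl ⟨hr, h⟩)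
  · rw [disjoint_right]
    simp only [mem_union, mem_filter, mem_insert, mem_singleton]
    rintro r (rfl | rfl)
    · simp [det2_self_left]
    · simp [det2_self_right]
  · rw [disjoint_left]
    simp only [mem_filter]
    rintro r h1 h2
    linarith [h1.2, h2.2]

lemma halvingEdge_iff_card (S : Finset Pt) (p q : Pt) :
    HalvingEdge S p q ↔ p ∈ S ∧ q ∈ S ∧ p ≠ q ∧
      #{r ∈ S | 0 < det2 p q r} = (#S - 2) / 2 ∧ #{r ∈ S | det2 p q r < 0} = (#S - 2) / 2 := by
  have key : ∀ f : Pt → Prop, ∀ [DecidablePred f],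
      {r ∈ (S : Set Pt) | f r}.ncard = #{r ∈ S | f r} := by
    intro f _
    rw [← Set.ncard_coe_finset, coe_filter]
    rfl
  unfold HalvingEdge
  rw [key, key]

lemma GenPos.halvingEdge_iff_lineForm {S : Finset Pt} (hS : GenPos S) (hcard : Even #S)
    {a b : ℝ} (hab : a ≠ 0 ∨ b ≠ 0) {p q : Pt} (hp : p ∈ S) (hq : q ∈ S) (hpq : p ≠ q)
    (h : lineForm a b p q = 0) :
    HalvingEdge S p q ↔ #{r ∈ S | 0 < lineForm a b p r} = (#S - 2) / 2 := by
  obtain ⟨s, h0, h1⟩ := exists_param_of_lineForm_eq_zero hab h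
  have hs : s ≠ 0 := by
    rintro rfl
    rcases coord_ne_of_ne hpq with h | h
    · exact h (by simpa using h0)
    · exact h (by simpa using h1)
  have hdet : ∀ r, det2 p q r = s * lineForm a b p r := by
    intro r
    unfold det2 lineForm
    rw [h0, h1]
    ring
  have hsum := hS.card_left_add_card_right hp hq hpq
  obtain ⟨n, hn⟩ := hcard
  rw [halvingEdge_iff_card]
  rcases lt_or_gt_of_ne hs with hs | hs
  · have : {r ∈ S | 0 < lineForm a b p r} = {r ∈ S | det2 p q r < 0} := by
      refine filter_congr fun r _ => ?_
      rw [hdet, mul_neg_iff]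
      simp [hs, hs.le.not_gt]
    rw [this]
    refine ⟨fun h => h.2.2.2.2, fun h => ⟨hp, hq, hpq, ?_, h⟩⟩
    omega
  · have : {r ∈ S | 0 < lineForm a b p r} = {r ∈ S | 0 < det2 p q r} := by
      refine filter_congr fun r _ => ?_
      rw [hdet, mul_pos_iff_of_pos_left hs]
    rw [this]
    refine ⟨fun h => h.2.2.2.1, fun h => ⟨hp, hq, hpq, h, ?_⟩⟩
    omega

lemma GenPos.halvingEdge_iff_card_left {S : Finset Pt} (hS : GenPos S) (hcard : Even #S)
    {p q : Pt} (hp : p ∈ S) (hq : q ∈ S) (hpq : p ≠ q) :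
    HalvingEdge S p q ↔ #{r ∈ S | 0 < det2 p q r} = (#S - 2) / 2 :=
  hS.halvingEdge_iff_lineForm hcard (coord_ne_of_ne hpq) hp hq hpq (by unfold lineForm; ring)

lemma HalvingEdge.symm {S : Finset Pt} {p q : Pt} (h : HalvingEdge S p q) :
    HalvingEdge S q p := by
  have hdet : ∀ r, det2 q p r = - det2 p q r := by
    intro r
    unfold det2
    ring
  obtain ⟨hp, hq, hpq, hl, hr⟩ := h
  refine ⟨hq, hp, hpq.symm, ?_, ?_⟩
  · simpa only [hdet, neg_pos] using hr
  · simpa only [hdet, neg_lt_zero] using hl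

lemma mem_neighborSet_halvingGraph {S : Finset Pt} {p q : Pt} :
    q ∈ (halvingGraph S).neighborSet p ↔ HalvingEdge S p q := by
  rw [SimpleGraph.mem_neighborSet, halvingGraph, SimpleGraph.fromRel_adj]
  exact ⟨fun h => h.2.elim id HalvingEdge.symm, fun h => ⟨h.2.2.1, Or.inl h⟩⟩

section AffineFamily

variable {ι : Type*} (Z : Finset ι) (α β : ι → ℝ)

/-- The number of members of the family `t ↦ α z + t * β z` that are positive at `t`. -/
def posCount (t : ℝ) : ℕ := #{z ∈ Z | 0 < α z + t * β z}

lemma eventually_pos_of_pos (x : ℝ) :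
    ∀ᶠ t in 𝓝 x, ∀ z ∈ Z, 0 < α z + x * β z → 0 < α z + t * β z := by
  rw [Filter.eventually_all_finset]
  intro z _
  rw [Filter.eventually_imp_distrib_left]
  intro h
  exact ContinuousAt.eventually_lt (f := fun _ => (0 : ℝ)) (g := fun t => α z + t * β z)
    (by fun_prop) (by fun_prop) h

lemma eventually_neg_of_neg (x : ℝ) :
    ∀ᶠ t in 𝓝 x, ∀ z ∈ Z, α z + x * β z < 0 → α z + t * β z < 0 := by
  filter_upwards [eventually_pos_of_pos Z (-α) (-β) x] with t ht z hz h
  have := ht z hz (by simp only [Pi.neg_apply]; linarith)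
  simp only [Pi.neg_apply] at this
  linarith

/-- If the positivity count never rises above `m` through an upward zero crossing, then it stays
at most `m`. -/
lemma posCount_le_of_le {m : ℕ} {a b : ℝ} (hab : a ≤ b)
    (huniq : ∀ t, ∀ z ∈ Z, ∀ z' ∈ Z, α z + t * β z = 0 → α z' + t * β z' = 0 → z = z')
    (hcross : ∀ t ∈ Set.Icc a b, ∀ z ∈ Z, α z + t * β z = 0 → posCount Z α β t = m → β z ≤ 0)
    (ha : posCount Z α β a ≤ m) : posCount Z α β b ≤ m := by
  classical
  have hclosed : IsClosed ({t | posCount Z α β t ≤ m} ∩ Set.Icc a b) := by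
    refine IsClosed.inter ?_ isClosed_Icc
    rw [← isOpen_compl_iff, isOpen_iff_mem_nhds]
    intro x hx
    filter_upwards [eventually_pos_of_pos Z α β x] with t ht
    simp only [Set.mem_compl_iff, Set.mem_ofPred_eq, not_le] at hx ⊢
    refine hx.trans_le (card_le_card fun z hz => ?_)
    rw [mem_filter] at hz ⊢
    exact ⟨hz.1, ht z hz.1 hz.2⟩
  refine hclosed.Icc_subset_of_forall_exists_gt ha ?_ ⟨hab, le_rfl⟩
  rintro x ⟨hx, hxab⟩ y hy
  have hx : posCount Z α β x ≤ m := hx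
  have hev : ∀ᶠ t in 𝓝[>] x, t ∈ Set.Ioc x y :=
    Ioc_mem_nhdsGT hy
  obtain ⟨t, ht, hneg⟩ := (hev.and ((eventually_neg_of_neg Z α β x).filter_mono
    nhdsWithin_le_nhds)).exists
  refine ⟨t, ?_, ht⟩
  change posCount Z α β t ≤ m
  have hnew : ∀ z ∈ Z, 0 < α z + t * β z → 0 < α z + x * β z ∨ α z + x * β z = 0 := by
    intro z hz h
    rcases lt_trichotomy (α z + x * β z) 0 with h' | h' | h'
    · exact absurd (hneg z hz h') h.not_gt
    · exact Or.inr h'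
    · exact Or.inl h'
  rcases hx.lt_or_eq with hlt | heq
  · refine le_trans ?_ hlt
    have : {z ∈ Z | α z + x * β z = 0}.card ≤ 1 := by
      rw [card_le_one]
      intro z hz z' hz'
      rw [mem_filter] at hz hz'
      exact huniq x z hz.1 z' hz'.1 hz.2 hz'.2
    refine (card_le_card (t := {z ∈ Z | 0 < α z + x * β z} ∪ {z ∈ Z | α z + x * β z = 0})
      fun z hz => ?_).trans ((card_union_le _ _).trans (Nat.add_le_add_left this _))
    rw [mem_filter] at hz
    rw [mem_union, mem_filter, mem_filter]
    exact (hnew z hz.1 hz.2).imp (And.intro hz.1) (And.intro hz.1)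
  · refine le_trans (card_le_card fun z hz => ?_) hx
    rw [mem_filter] at hz ⊢
    refine ⟨hz.1, (hnew z hz.1 hz.2).resolve_right fun h0 => ?_⟩
    have hβ := hcross x ⟨hxab.1, hxab.2.le⟩ z hz.1 h0 heq
    nlinarith [hz.2, ht.1]

/-- Just before a downward zero crossing at level `m`, the positivity count exceeds `m`. -/
lemma exists_lt_posCount_of_crossing {m : ℕ} {s x : ℝ} (hs : s < x) {z : ι} (hz : z ∈ Z)
    (h0 : α z + x * β z = 0) (hβ : β z < 0) (hx : posCount Z α β x = m) :
    ∃ t ∈ Set.Ico s x, m < posCount Z α β t := by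
  have hev : ∀ᶠ t in 𝓝[<] x, t ∈ Set.Ico s x := Ico_mem_nhdsLT hs
  obtain ⟨t, ht, hpos⟩ := (hev.and ((eventually_pos_of_pos Z α β x).filter_mono
    nhdsWithin_le_nhds)).exists
  refine ⟨t, ht, hx ▸ card_lt_card ?_⟩
  rw [ssubset_iff_of_subset]
  · refine ⟨z, ?_, ?_⟩
    · rw [mem_filter]
      exact ⟨hz, by nlinarith [ht.2]⟩
    · rw [mem_filter]
      exact fun h => h.2.ne' h0
  · intro y hy
    rw [mem_filter] at hy ⊢
    exact ⟨hy.1, hpos y hy.1 hy.2⟩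

/-- If all zero crossings at level `m` are downward, then the positivity count passes from above
`m` to at most `m` exactly when there is such a crossing, and there is at most one. -/
lemma crossing_of_downward {m : ℕ} {a b : ℝ} (hab : a ≤ b)
    (huniq : ∀ t, ∀ z ∈ Z, ∀ z' ∈ Z, α z + t * β z = 0 → α z' + t * β z' = 0 → z = z')
    (hcross : ∀ t ∈ Set.Icc a b, ∀ z ∈ Z, α z + t * β z = 0 → posCount Z α β t = m → β z < 0)
    (hne : ∀ z ∈ Z, α z + a * β z = 0 → posCount Z α β a ≠ m) :
    ((m < posCount Z α β a ∧ posCount Z α β b ≤ m) ↔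
      ∃ t ∈ Set.Icc a b, ∃ z ∈ Z, α z + t * β z = 0 ∧ posCount Z α β t = m) ∧
    (∀ t ∈ Set.Icc a b, ∀ t' ∈ Set.Icc a b, ∀ z ∈ Z, ∀ z' ∈ Z,
      α z + t * β z = 0 → posCount Z α β t = m →
      α z' + t' * β z' = 0 → posCount Z α β t' = m → z = z') := by
  have hmono : ∀ t ∈ Set.Icc a b, ∀ t' ∈ Set.Icc a b, t ≤ t' →
      posCount Z α β t ≤ m → posCount Z α β t' ≤ m := by
    intro t ht t' ht' htt' h
    exact posCount_le_of_le Z α β htt' huniq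
      (fun r hr z hz h0 hm => (hcross r ⟨ht.1.trans hr.1, hr.2.trans ht'.2⟩ z hz h0 hm).le) h
  have hbefore : ∀ t ∈ Set.Icc a b, ∀ s ∈ Set.Icc a b, s < t → ∀ z ∈ Z, α z + t * β z = 0 →
      posCount Z α β t = m → m < posCount Z α β s := by
    intro t ht s hs hst z hz h0 hm
    obtain ⟨r, hr, hlt⟩ := exists_lt_posCount_of_crossing Z α β hst hz h0 (hcross t ht z hz h0 hm) hm
    by_contra! hle
    exact hlt.not_ge (hmono s hs r ⟨hs.1.trans hr.1, hr.2.le.trans ht.2⟩ hr.1 hle)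
  refine ⟨⟨?_, ?_⟩, ?_⟩
  · rintro ⟨hma, hmb⟩
    by_contra! hno
    refine hma.not_ge ?_
    have hrefl : ∀ t, posCount Z α (-β) t = posCount Z α β (-t) := by
      intro t
      simp [posCount]
    have := posCount_le_of_le Z α (-β) (m := m) (a := -b) (b := -a) (by linarith)
      (fun t z hz z' hz' h h' => huniq (-t) z hz z' hz'
        (by simpa using h) (by simpa using h'))
      (fun t ht z hz h0 hm => absurd ((hrefl t).symm.trans hm)
        (hno (-t) ⟨by linarith [ht.2], by linarith [ht.1]⟩ z hz (by simpa using h0)))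
      (by rw [hrefl, neg_neg]; exact hmb)
    rwa [hrefl, neg_neg] at this
  · rintro ⟨t, ht, z, hz, h0, hm⟩
    have hat : a < t := lt_of_le_of_ne ht.1 (by rintro rfl; exact hne z hz h0 hm)
    exact ⟨hbefore t ht a ⟨le_rfl, hab⟩ hat z hz h0 hm,
      hmono t ht b ⟨hab, le_rfl⟩ ht.2 hm.le⟩
  · intro t ht t' ht' z hz z' hz' h0 hm h0' hm'
    rcases lt_trichotomy t t' with h | rfl | h
    · exact absurd hm (hbefore t' ht' t ht h z' hz' h0' hm').ne'
    · exact huniq t z hz z' hz' h0 h0'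
    · exact absurd hm' (hbefore t ht t' ht' h z hz h0 hm).ne'

end AffineFamily

lemma tiltForm_eq (v w p z : Pt) (t : ℝ) :
    tiltForm v w t p z = lineForm (w 0 - v 0) (w 1 - v 1) p z +
      t * lineForm (-(w 1 - v 1)) (w 0 - v 0) p z := by
  unfold tiltForm lineForm
  ring

lemma tiltForm_self (v w p : Pt) (t : ℝ) : tiltForm v w t p p = 0 := by
  unfold tiltForm lineForm
  ring

lemma tiltForm_target (v w : Pt) (t : ℝ) :
    tiltForm v w t v w = -t * ((w 0 - v 0) ^ 2 + (w 1 - v 1) ^ 2) := by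
  unfold tiltForm lineForm
  ring

lemma tilt_direction_ne_zero {v w : Pt} (h : v ≠ w) (t : ℝ) :
    (w 0 - v 0) - t * (w 1 - v 1) ≠ 0 ∨ (w 1 - v 1) + t * (w 0 - v 0) ≠ 0 := by
  have hpos := sq_add_sq_pos (coord_ne_of_ne h)
  by_contra! hc
  nlinarith [mul_pos (show 0 < 1 + t ^ 2 by positivity) hpos]

/-- All sufficiently small tilts keep the points of `S` on their sides of the lines through two
other points of `S`. -/
lemma exists_tilt (S : Finset Pt) :
    ∃ τ > 0, ∀ v ∈ S, ∀ w ∈ S, ∀ u ∈ S, ∀ σ : ℝ, |σ| ≤ τ →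
      (0 < det2 v w u → 0 < tiltForm v w σ v u) ∧ (det2 v w u < 0 → tiltForm v w σ v u < 0) := by
  have hev : ∀ᶠ t in 𝓝 (0 : ℝ), ∀ v ∈ S, ∀ w ∈ S, ∀ u ∈ S,
      (0 < det2 v w u → 0 < tiltForm v w t v u) ∧
        (det2 v w u < 0 → tiltForm v w t v u < 0) := by
    simp only [Filter.eventually_all_finset]
    intro v _ w _ u _
    have hcont : Continuous fun t => tiltForm v w t v u := by
      unfold tiltForm lineForm
      fun_prop
    have h0 : tiltForm v w 0 v u = det2 v w u := by
      unfold tiltForm lineForm det2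
      ring
    refine Filter.Eventually.and ?_ ?_
    · rw [Filter.eventually_imp_distrib_left]
      intro h
      exact hcont.continuousAt.eventually_const_lt (h.trans_eq h0.symm)
    · rw [Filter.eventually_imp_distrib_left]
      intro h
      exact hcont.continuousAt.eventually_lt_const (h0.trans_lt h)
  obtain ⟨δ, hδ, h⟩ := Metric.eventually_nhds_iff.1 hev
  refine ⟨δ / 2, by positivity, fun v hv w hw u hu σ hσ => h ?_ v hv w hw u hu⟩
  rw [Real.dist_eq, sub_zero]
  linarith

lemma eventually_forall_dist_le {P : Pt → Pt → Prop} {v u : Pt}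
    (h : ∀ᶠ x in 𝓝 (v, u), P x.1 x.2) :
    ∀ᶠ ε in 𝓝[>] (0 : ℝ), ∀ p z, dist p v ≤ ε → dist z u ≤ ε → P p z := by
  obtain ⟨δ, hδ, h⟩ := Metric.eventually_nhds_iff.1 h
  filter_upwards [Ioo_mem_nhdsGT hδ] with ε hε p z hp hz
  refine h (y := (p, z)) ?_
  rw [Prod.dist_eq]
  exact max_lt (hp.trans_lt hε.2) (hz.trans_lt hε.2)

/-- Moving both points slightly keeps the sign of the tilted forms. -/
lemma exists_radius (S : Finset Pt) (τ : ℝ) :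
    ∃ ε₀ > 0, ∀ v ∈ S, ∀ w ∈ S, ∀ u ∈ S, ∀ σ ∈ ({τ, -τ} : Finset ℝ), ∀ p z,
      dist p v ≤ ε₀ → dist z u ≤ ε₀ →
        (0 < tiltForm v w σ v u → 0 < tiltForm v w σ p z) ∧
        (tiltForm v w σ v u < 0 → tiltForm v w σ p z < 0) := by
  have hev : ∀ᶠ ε in 𝓝[>] (0 : ℝ), ∀ v ∈ S, ∀ w ∈ S, ∀ u ∈ S, ∀ σ ∈ ({τ, -τ} : Finset ℝ),
      ∀ p z, dist p v ≤ ε → dist z u ≤ ε →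
        (0 < tiltForm v w σ v u → 0 < tiltForm v w σ p z) ∧
        (tiltForm v w σ v u < 0 → tiltForm v w σ p z < 0) := by
    simp only [Filter.eventually_all_finset]
    intro v _ w _ u _ σ _
    have hcont : Continuous fun x : Pt × Pt => tiltForm v w σ x.1 x.2 := by
      unfold tiltForm lineForm
      fun_prop
    refine eventually_forall_dist_le (P := fun p z =>
      (0 < tiltForm v w σ v u → 0 < tiltForm v w σ p z) ∧
        (tiltForm v w σ v u < 0 → tiltForm v w σ p z < 0)) (Filter.Eventually.and ?_ ?_)
    · rw [Filter.eventually_imp_distrib_left]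
      exact fun h => hcont.continuousAt.eventually_const_lt h
    · rw [Filter.eventually_imp_distrib_left]
      exact fun h => hcont.continuousAt.eventually_lt_const h
  obtain ⟨ε, h, hε⟩ := (hev.and self_mem_nhdsWithin).exists
  exact ⟨ε, hε, h⟩

namespace IsFission

variable {S H : Finset Pt} {k : ℕ} {ε : ℝ} {cl : Pt → Finset Pt}

lemma mem_iff (hH : IsFission S k ε H cl) {z : Pt} : z ∈ H ↔ ∃ u ∈ S, z ∈ cl u := by
  rw [← mem_coe, hH.union_eq]
  simp

lemma eq_biUnion (hH : IsFission S k ε H cl) : H = S.biUnion cl := by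
  ext z
  rw [hH.mem_iff, mem_biUnion]

lemma eq_of_mem (hH : IsFission S k ε H cl) {u w z : Pt} (hu : u ∈ S) (hw : w ∈ S)
    (hzu : z ∈ cl u) (hzw : z ∈ cl w) : u = w := by
  by_contra h
  exact disjoint_left.1 (hH.disj u hu w hw h) hzu hzw

lemma card_eq (hH : IsFission S k ε H cl) : #H = #S * k := by
  rw [hH.eq_biUnion, card_biUnion hH.disj, sum_const_nat hH.cluster_card]

/-- If membership in a side is constant on all clusters but one, which is not entirely contained
in it, then the number of points on that side is determined by `S` up to less than `k`. -/
lemma card_filter_bounds (hH : IsFission S k ε H cl) {v p : Pt} (hv : v ∈ S) (hp : p ∈ cl v)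
    (P Q : Pt → Prop) [DecidablePred P] [DecidablePred Q]
    (hPQ : ∀ u ∈ S, u ≠ v → ∀ z ∈ cl u, (P z ↔ Q u)) (hPp : ¬ P p) (hQv : ¬ Q v) :
    k * #{u ∈ S | Q u} ≤ #{z ∈ H | P z} ∧ #{z ∈ H | P z} < k * #{u ∈ S | Q u} + k := by
  have hc : #{z ∈ cl v | P z} < k := by
    rw [← hH.cluster_card v hv]
    refine card_lt_card (filter_ssubset.2 ⟨p, hp, hPp⟩)
  have hsum : #{z ∈ H | P z} = k * #{u ∈ S | Q u} + #{z ∈ cl v | P z} := by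
    rw [hH.eq_biUnion, filter_biUnion, card_biUnion]
    · have hterm : ∀ u ∈ S, #{z ∈ cl u | P z} =
          (if Q u then k else 0) + (if v = u then #{z ∈ cl v | P z} else 0) := by
        intro u hu
        by_cases huv : v = u
        · subst huv
          simp [hQv]
        · rw [if_neg huv, add_zero]
          split_ifs with hQ
          · rw [filter_true_of_mem fun z hz => (hPQ u hu (Ne.symm huv) z hz).2 hQ,
              hH.cluster_card u hu]
          · rw [filter_false_of_mem fun z hz h => hQ ((hPQ u hu (Ne.symm huv) z hz).1 h),
              card_empty]
      rw [sum_congr rfl hterm, sum_add_distrib, sum_ite_eq, if_pos hv, ← sum_filter, sum_const,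
        smul_eq_mul, mul_comm]
    · intro u hu w hw huw
      exact disjoint_filter_filter (hH.disj u hu w hw huw)
  omega

end IsFission

/-- In a sufficiently tight plain fission, a point of the `v`-cluster has exactly one halving
neighbour in the `w`-cluster if `{v, w}` is a halving edge, and none otherwise. -/
lemma exists_radius_cluster_neighbor (S : Finset Pt) (hS : GenPos S) (hcard : Even #S)
    (k : ℕ) (hk : 1 ≤ k) :
    ∃ ε₀ > 0, ∀ ε ≤ ε₀, ∀ (H : Finset Pt) (cl : Pt → Finset Pt), IsFission S k ε H cl →
      IsPlain S H cl → ∀ v ∈ S, ∀ w ∈ S, v ≠ w → ∀ p ∈ cl v,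
        (HalvingEdge S v w ↔ ∃ q ∈ cl w, HalvingEdge H p q) ∧
        ∀ q ∈ cl w, ∀ q' ∈ cl w, HalvingEdge H p q → HalvingEdge H p q' → q = q' := by
  obtain ⟨τ, hτ, htilt⟩ := exists_tilt S
  obtain ⟨ε₀, hε₀, hsign⟩ := exists_radius S τ
  refine ⟨ε₀, hε₀, fun ε hε H cl hH hplain v hv w hw hvw p hp => ?_⟩
  have hpH : p ∈ H := hH.mem_iff.2 ⟨v, hv, hp⟩
  have hclose : ∀ u ∈ S, ∀ z ∈ cl u, dist z u ≤ ε₀ := fun u hu z hz =>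
    (hH.close u hu z hz).trans hε
  have hHcard : Even #H := by
    rw [hH.card_eq]
    exact hcard.mul_right k
  have hnorm := sq_add_sq_pos (coord_ne_of_ne hvw)
  have hfwd : ∀ z ∈ cl w, 0 < tiltForm v w (-τ) p z ∧ tiltForm v w τ p z < 0 := by
    intro z hz
    refine ⟨(hsign v hv w hw w hw (-τ) (by simp) p z (hclose v hv p hp) (hclose w hw z hz)).1 ?_,
      (hsign v hv w hw w hw τ (by simp) p z (hclose v hv p hp) (hclose w hw z hz)).2 ?_⟩
    · rw [tiltForm_target]
      nlinarith
    · rw [tiltForm_target]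
      nlinarith
  have hside : ∀ u ∈ S, u ≠ v → u ≠ w → ∀ z ∈ cl u, ∀ σ ∈ ({τ, -τ} : Finset ℝ),
      (0 < det2 v w u ∧ 0 < tiltForm v w σ p z) ∨ (det2 v w u < 0 ∧ tiltForm v w σ p z < 0) := by
    intro u hu huv huw z hz σ hσ
    have hσ' : |σ| ≤ τ := by
      rw [mem_insert, mem_singleton] at hσ
      rcases hσ with rfl | rfl
      · exact (abs_of_pos hτ).le
      · rw [abs_neg, abs_of_pos hτ]
    have h1 := htilt v hv w hw u hu σ hσ'
    have h2 := hsign v hv w hw u hu σ hσ p z (hclose v hv p hp) (hclose u hu z hz)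
    rcases lt_or_gt_of_ne (hS.det2_ne_zero hv hw hu hvw huv.symm huw.symm) with h | h
    · exact Or.inr ⟨h, h2.2 (h1.2 h)⟩
    · exact Or.inl ⟨h, h2.1 (h1.1 h)⟩
  set Z := H.erase p with hZ
  set α : Pt → ℝ := lineForm (w 0 - v 0) (w 1 - v 1) p
  set β : Pt → ℝ := lineForm (-(w 1 - v 1)) (w 0 - v 0) p
  have hform : ∀ t z, α z + t * β z = tiltForm v w t p z := fun t z =>
    (tiltForm_eq v w p z t).symm
  have hcount : ∀ t, posCount Z α β t = #{z ∈ H | 0 < tiltForm v w t p z} := by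
    intro t
    unfold posCount
    congr 1
    ext z
    simp only [hform, hZ, mem_filter, mem_erase]
    refine ⟨fun h => ⟨h.1.2, h.2⟩, fun h => ⟨⟨?_, h.1⟩, h.2⟩⟩
    rintro rfl
    exact h.2.ne' (tiltForm_self v w z t)
  have hhalf : ∀ t, ∀ z ∈ Z, α z + t * β z = 0 →
      (HalvingEdge H p z ↔ posCount Z α β t = (#H - 2) / 2) := by
    intro t z hz h0
    rw [hcount]
    rw [hform] at h0
    exact hH.genPos.halvingEdge_iff_lineForm hHcard (tilt_direction_ne_zero hvw t) hpH
      (mem_of_mem_erase hz) (ne_of_mem_erase hz).symm h0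
  have hβneg : ∀ z ∈ cl w, β z < 0 := by
    intro z hz
    have h := hfwd z hz
    rw [← hform, ← hform] at h
    nlinarith
  have hZcl : ∀ z ∈ cl w, z ∈ Z := by
    intro z hz
    refine mem_erase.2 ⟨?_, hH.mem_iff.2 ⟨w, hw, hz⟩⟩
    rintro rfl
    exact hvw (hH.eq_of_mem hv hw hp hz)
  have hloc : ∀ t ∈ Set.Icc (-τ) τ, ∀ z ∈ Z, α z + t * β z = 0 →
      posCount Z α β t = (#H - 2) / 2 → z ∈ cl w := by
    intro t ht z hz h0 hm
    obtain ⟨u, hu, hzu⟩ := hH.mem_iff.1 (mem_of_mem_erase hz)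
    by_cases huw : u = w
    · exact huw ▸ hzu
    by_cases huv : u = v
    · exact absurd ((hhalf t z hz h0).2 hm) (hplain v hv p hp z (huv ▸ hzu))
    have h1 := hside u hu huv huw z hzu τ (by simp)
    have h2 := hside u hu huv huw z hzu (-τ) (by simp)
    rw [← hform] at h1 h2
    rcases h1 with h1 | h1 <;> rcases h2 with h2 | h2
    · rcases le_total 0 (β z) with hb | hb <;> nlinarith [ht.1, ht.2]
    · linarith
    · linarith
    · rcases le_total 0 (β z) with hb | hb <;> nlinarith [ht.1, ht.2]
  have hzero : ∀ z ∈ cl w, ∃ t ∈ Set.Icc (-τ) τ, α z + t * β z = 0 := by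
    intro z hz
    have h := hfwd z hz
    rw [← hform, ← hform] at h
    have hb := hβneg z hz
    refine ⟨-α z / β z, ⟨?_, ?_⟩, ?_⟩
    · rw [le_div_iff_of_neg hb]
      linarith
    · rw [div_le_iff_of_neg hb]
      linarith
    · rw [div_mul_cancel₀ _ hb.ne]
      ring
  obtain ⟨hiff, hunique⟩ := crossing_of_downward Z α β (m := (#H - 2) / 2) (a := -τ) (b := τ)
    (by linarith)
    (fun t z hz z' hz' h0 h0' => hH.genPos.eq_of_lineForm_eq_zero (tilt_direction_ne_zero hvw t)
      hpH (mem_of_mem_erase hz) (mem_of_mem_erase hz') (ne_of_mem_erase hz).symm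
      (ne_of_mem_erase hz').symm ((hform t z).symm.trans h0) ((hform t z').symm.trans h0'))
    (fun t ht z hz h0 hm => hβneg z (hloc t ht z hz h0 hm))
    (fun z hz h0 hm => ((hform _ z).symm.trans h0).not_gt
      (hfwd z (hloc _ ⟨le_rfl, by linarith⟩ z hz h0 hm)).1)
  refine ⟨?_, ?_⟩
  · have hexists : (∃ q ∈ cl w, HalvingEdge H p q) ↔ ∃ t ∈ Set.Icc (-τ) τ, ∃ z ∈ Z,
        α z + t * β z = 0 ∧ posCount Z α β t = (#H - 2) / 2 := by
      constructor
      · rintro ⟨q, hq, hpq⟩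
        obtain ⟨t, ht, h0⟩ := hzero q hq
        exact ⟨t, ht, q, hZcl q hq, h0, (hhalf t q (hZcl q hq) h0).1 hpq⟩
      · rintro ⟨t, ht, z, hz, h0, hm⟩
        exact ⟨z, hloc t ht z hz h0 hm, (hhalf t z hz h0).2 hm⟩
    rw [hexists, ← hiff, hcount, hcount, hS.halvingEdge_iff_card_left hcard hv hw hvw]
    have hafter := hH.card_filter_bounds hv hp (fun z => 0 < tiltForm v w τ p z)
      (fun u => 0 < det2 v w u)
      (by
        intro u hu huv z hz
        by_cases huw : u = w
        · subst huw
          exact iff_of_false (hfwd z hz).2.not_gt (det2_self_right _ _).not_gt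
        · rcases hside u hu huv huw z hz τ (by simp) with h | h
          · exact iff_of_true h.2 h.1
          · exact iff_of_false h.2.not_gt h.1.not_gt)
      (by simp [tiltForm_self]) (by simp [det2_self_left])
    have hbefore := hH.card_filter_bounds hv hp (fun z => 0 < tiltForm v w (-τ) p z)
      (fun u => u = w ∨ 0 < det2 v w u)
      (by
        intro u hu huv z hz
        by_cases huw : u = w
        · subst huw
          exact iff_of_true (hfwd z hz).1 (Or.inl rfl)
        · rcases hside u hu huv huw z hz (-τ) (by simp) with h | h
          · exact iff_of_true h.2 (Or.inr h.1)
          · exact iff_of_false h.2.not_gt (not_or.2 ⟨huw, h.1.not_gt⟩))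
      (by simp [tiltForm_self]) (by simp [det2_self_left, hvw])
    have hins : #{u ∈ S | u = w ∨ 0 < det2 v w u} = #{u ∈ S | 0 < det2 v w u} + 1 := by
      rw [← card_insert_of_notMem (a := w) (by simp [det2_self_right])]
      congr 1
      ext u
      simp only [mem_filter, mem_insert]
      refine ⟨fun h => h.2.imp id (And.intro h.1), ?_⟩
      rintro (rfl | h)
      · exact ⟨hw, Or.inl rfl⟩
      · exact ⟨h.1, Or.inr h.2⟩
    rw [hins] at hbefore
    obtain ⟨j, hj⟩ := hcard
    have hjpos : 1 ≤ j := by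
      have := card_pos.2 ⟨v, hv⟩
      omega
    have hHj : #H = k * j + k * j := by
      rw [hH.card_eq, hj]
      ring
    have hkj : 1 ≤ k * j := Nat.mul_pos hk hjpos
    have hhalfS : (#S - 2) / 2 = j - 1 := by omega
    have hhalfH : (#H - 2) / 2 = k * j - 1 := by omega
    rw [hhalfS, hhalfH]
    generalize #{u ∈ S | 0 < det2 v w u} = l at *
    constructor
    · intro hl
      have : l + 1 = j := by omega
      subst this
      rw [mul_add, mul_one] at *
      omega
    · rintro ⟨h1, h2⟩
      have h3 : k * l < k * j := by omega
      have h4 : k * j < k * (l + 1 + 1) := by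
        rw [mul_add k (l + 1) 1]
        omega
      have := lt_of_mul_lt_mul_left' h3
      have := lt_of_mul_lt_mul_left' h4
      omega
  · intro q hq q' hq' hpq hpq'
    obtain ⟨t, ht, h0⟩ := hzero q hq
    obtain ⟨t', ht', h0'⟩ := hzero q' hq'
    exact hunique t ht t' ht' q (hZcl q hq) q' (hZcl q' hq') h0 ((hhalf t q (hZcl q hq) h0).1 hpq)
      h0' ((hhalf t' q' (hZcl q' hq') h0').1 hpq')

theorem stmt10 (S : Finset Pt) (hS : GenPos S) (hcard : Even S.card)
    (k : ℕ) (hk : 1 ≤ k) :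
    ∃ ε₀ > 0, ∀ ε : ℝ, 0 < ε → ε ≤ ε₀ →
      ∀ (H : Finset Pt) (cl : Pt → Finset Pt), IsFission S k ε H cl → IsPlain S H cl →
        ∀ v ∈ S, ∀ x ∈ cl v,
          ((halvingGraph H).neighborSet x).ncard =
            ((halvingGraph S).neighborSet v).ncard := by
  obtain ⟨ε₀, hε₀, hmain⟩ := exists_radius_cluster_neighbor S hS hcard k hk
  refine ⟨ε₀, hε₀, fun ε _ hε H cl hH hplain v hv x hx => Eq.symm ?_⟩
  have hnbr := hmain ε hε H cl hH hplain v hv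
  have hex : ∀ w ∈ (halvingGraph S).neighborSet v, ∃ q ∈ cl w, HalvingEdge H x q := by
    intro w hw
    rw [mem_neighborSet_halvingGraph] at hw
    exact (hnbr w hw.2.1 hw.2.2.1 x hx).1.1 hw
  choose f hfcl hfedge using hex
  refine Set.ncard_congr f (fun w hw => mem_neighborSet_halvingGraph.2 (hfedge w hw)) ?_ ?_
  · intro w w' hw hw' h
    have hwS := (mem_neighborSet_halvingGraph.1 hw).2.1
    have hwS' := (mem_neighborSet_halvingGraph.1 hw').2.1
    exact hH.eq_of_mem hwS hwS' (hfcl w hw) (h ▸ hfcl w' hw')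
  · intro q hq
    rw [mem_neighborSet_halvingGraph] at hq
    obtain ⟨w, hwS, hqw⟩ := hH.mem_iff.1 hq.2.1
    have hvw : v ≠ w := by
      rintro rfl
      exact hplain v hv x hx q hqw hq
    have hw : w ∈ (halvingGraph S).neighborSet v :=
      mem_neighborSet_halvingGraph.2 ((hnbr w hwS hvw x hx).1.2 ⟨q, hqw, hq⟩)
    exact ⟨w, hw, (hnbr w hwS hvw x hx).2 _ (hfcl w hw) q hqw (hfedge w hw) hq⟩

end
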